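/- Let F be the free Lie superalgebra on a ℤ/2-graded set X over a commutative unital ring K. Then the Lie superalgebra homomorphism F ∧ F → F, x ∧ y ↦ [x,y], is injective; hence F ∧ F ≅ [F,F]. -/

import Mathlib

open scoped TensorProduct

namespace SuperNA

/-- The sign `(-1)^(|α||β|)` appearing in super-algebra identities. -/
def ssign (α β : ZMod 2) : ℤ := (-1 : ℤ) ^ (α.val * β.val)

/-- A Lie superalgebra over a commutative unital ring `K`: a `ℤ/2`-graded `K`-module
with a bilinear bracket satisfying the graded skew-symmetry, the graded Jacobi
(Leibniz form) identity, and `[x₀,x₀] = 0` for even `x₀`. -/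
structure LieSuperalgebra (K : Type) [CommRing K] : Type 1 where
  carrier : Type
  [isAddCommGroup : AddCommGroup carrier]
  [isModule : Module K carrier]
  grading : ZMod 2 → Submodule K carrier
  isInternal : DirectSum.IsInternal grading
  bracket : carrier →ₗ[K] carrier →ₗ[K] carrier
  bracket_grading : ∀ (α β : ZMod 2) (x y : carrier),
    x ∈ grading α → y ∈ grading β → bracket x y ∈ grading (α + β)
  super_skew : ∀ (α β : ZMod 2) (x y : carrier), x ∈ grading α → y ∈ grading β →
    bracket x y = -(ssign α β • bracket y x)
  super_jacobi : ∀ (α β : ZMod 2) (x y : carrier), x ∈ grading α → y ∈ grading β →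
    ∀ z : carrier, bracket x (bracket y z)
      = bracket (bracket x y) z + ssign α β • bracket y (bracket x z)
  bracket_self_even : ∀ x ∈ grading 0, bracket x x = 0

attribute [instance] LieSuperalgebra.isAddCommGroup LieSuperalgebra.isModule

variable {K : Type} [CommRing K]

instance : CoeSort (LieSuperalgebra K) Type := ⟨LieSuperalgebra.carrier⟩

/-- A homomorphism of Lie superalgebras: an even linear map preserving brackets. -/
structure LieSuperHom (L M : LieSuperalgebra K) where
  toLinear : L.carrier →ₗ[K] M.carrier
  map_grading : ∀ (α : ZMod 2), ∀ x ∈ L.grading α, toLinear x ∈ M.grading α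
  map_bracket : ∀ x y, toLinear (L.bracket x y) = M.bracket (toLinear x) (toLinear y)

/-- An action of the Lie superalgebra `P` on the Lie superalgebra `M`. -/
structure LieSuperAction (P M : LieSuperalgebra K) where
  act : P.carrier →ₗ[K] M.carrier →ₗ[K] M.carrier
  act_grading : ∀ (α β : ZMod 2) (p : P.carrier) (m : M.carrier),
    p ∈ P.grading α → m ∈ M.grading β → act p m ∈ M.grading (α + β)
  act_bracket : ∀ (α β : ZMod 2) (p p' : P.carrier), p ∈ P.grading α → p' ∈ P.grading β →
    ∀ m : M.carrier, act (P.bracket p p') m = act p (act p' m) - ssign α β • act p' (act p m)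
  act_super_der : ∀ (α β : ZMod 2) (p : P.carrier) (m : M.carrier),
    p ∈ P.grading α → m ∈ M.grading β → ∀ m' : M.carrier,
    act p (M.bracket m m') = M.bracket (act p m) m' + ssign α β • M.bracket m (act p m')

/-- Two mutual actions are compatible. -/
structure AreCompatible {M N : LieSuperalgebra K}
    (aMN : LieSuperAction M N) (aNM : LieSuperAction N M) : Prop where
  compat_left : ∀ (α β : ZMod 2) (m : M.carrier) (n : N.carrier),
    m ∈ M.grading α → n ∈ N.grading β → ∀ n' : N.carrier,
    aMN.act (aNM.act n m) n' = -(ssign α β • N.bracket (aMN.act m n) n')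
  compat_right : ∀ (α β : ZMod 2) (m : M.carrier) (n : N.carrier),
    m ∈ M.grading α → n ∈ N.grading β → ∀ m' : M.carrier,
    aNM.act (aMN.act m n) m' = -(ssign α β • M.bracket (aNM.act n m) m')

/-- A crossed module of Lie superalgebras `∂ : M → P`. -/
structure CrossedModule (M P : LieSuperalgebra K) where
  act : LieSuperAction P M
  d : LieSuperHom M P
  cm_act : ∀ (p : P.carrier) (m : M.carrier), d.toLinear (act.act p m) = P.bracket p (d.toLinear m)
  cm_peiffer : ∀ (m m' : M.carrier), act.act (d.toLinear m) m' = M.bracket m m'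

/-- A morphism of crossed `P`-modules. -/
structure CMHom {P M N : LieSuperalgebra K} (cmM : CrossedModule M P) (cmN : CrossedModule N P) where
  hom : LieSuperHom M N
  equivariant : ∀ (p : P.carrier) (m : M.carrier),
    hom.toLinear (cmM.act.act p m) = cmN.act.act p (hom.toLinear m)
  comm : ∀ m : M.carrier, cmN.d.toLinear (hom.toLinear m) = cmM.d.toLinear m

/-- The data of a family of "tensor symbols" in a Lie superalgebra `Q`, indexed by pairs of
homogeneous elements of `M` and `N`, satisfying the defining relations of the non-abelian
tensor product `M ⊗ N`. -/
structure TensorData {M N : LieSuperalgebra K}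
    (aMN : LieSuperAction M N) (aNM : LieSuperAction N M) (Q : LieSuperalgebra K) where
  pair : (α β : ZMod 2) → M.grading α → N.grading β → Q.carrier
  pair_grading : ∀ (α β : ZMod 2) (m : M.grading α) (n : N.grading β),
    pair α β m n ∈ Q.grading (α + β)
  pair_smul_left : ∀ (α β : ZMod 2) (c : K) (m : M.grading α) (n : N.grading β),
    pair α β (c • m) n = c • pair α β m n
  pair_smul_right : ∀ (α β : ZMod 2) (c : K) (m : M.grading α) (n : N.grading β),
    pair α β m (c • n) = c • pair α β m n
  pair_add_left : ∀ (α β : ZMod 2) (m m' : M.grading α) (n : N.grading β),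
    pair α β (m + m') n = pair α β m n + pair α β m' n
  pair_add_right : ∀ (α β : ZMod 2) (m : M.grading α) (n n' : N.grading β),
    pair α β m (n + n') = pair α β m n + pair α β m n'
  pair_bracket_left : ∀ (α α' β : ZMod 2) (m : M.grading α) (m' : M.grading α') (n : N.grading β),
    pair (α + α') β ⟨M.bracket m.1 m'.1, M.bracket_grading α α' m.1 m'.1 m.2 m'.2⟩ n
      = pair α (α' + β) m ⟨aMN.act m'.1 n.1, aMN.act_grading α' β m'.1 n.1 m'.2 n.2⟩
        - ssign α α' • pair α' (α + β) m' ⟨aMN.act m.1 n.1, aMN.act_grading α β m.1 n.1 m.2 n.2⟩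
  pair_bracket_right : ∀ (α β β' : ZMod 2) (m : M.grading α) (n : N.grading β) (n' : N.grading β'),
    pair α (β + β') m ⟨N.bracket n.1 n'.1, N.bracket_grading β β' n.1 n'.1 n.2 n'.2⟩
      = ssign β' (α + β) • pair (β' + α) β
          ⟨aNM.act n'.1 m.1, aNM.act_grading β' α n'.1 m.1 n'.2 m.2⟩ n
        - ssign α β • pair (β + α) β'
          ⟨aNM.act n.1 m.1, aNM.act_grading β α n.1 m.1 n.2 m.2⟩ n'
  pair_bracket_pair : ∀ (α β α' β' : ZMod 2) (m : M.grading α) (n : N.grading β)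
      (m' : M.grading α') (n' : N.grading β'),
    Q.bracket (pair α β m n) (pair α' β' m' n')
      = -(ssign α β • pair (β + α) (α' + β')
          ⟨aNM.act n.1 m.1, aNM.act_grading β α n.1 m.1 n.2 m.2⟩
          ⟨aMN.act m'.1 n'.1, aMN.act_grading α' β' m'.1 n'.1 m'.2 n'.2⟩)

/-- `(T, ι)` is *the* non-abelian tensor product `M ⊗ N`: it is initial among Lie
superalgebras equipped with tensor symbols satisfying the defining relations.  This
universal property characterizes the Lie superalgebra presented by the generators
`m ⊗ n` and the relations of the non-abelian tensor product, uniquely up to isomorphism. -/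
def IsNATensor {M N : LieSuperalgebra K} (aMN : LieSuperAction M N) (aNM : LieSuperAction N M)
    (T : LieSuperalgebra K) (ι : TensorData aMN aNM T) : Prop :=
  ∀ (Q : LieSuperalgebra K) (d : TensorData aMN aNM Q),
    ∃! f : LieSuperHom T Q,
      ∀ (α β : ZMod 2) (m : M.grading α) (n : N.grading β),
        f.toLinear (ι.pair α β m n) = d.pair α β m n

/-- Tensor-symbol data additionally satisfying the relations of the non-abelian
exterior square `L ∧ L` (relative to an action `a` of `L` on itself). -/
structure ExtSqData {L : LieSuperalgebra K} (a : LieSuperAction L L) (Q : LieSuperalgebra K)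
    extends TensorData a a Q where
  pair_alt : ∀ (α β : ZMod 2) (x : L.grading α) (y : L.grading β),
    toTensorData.pair α β x y + ssign α β • toTensorData.pair β α y x = 0
  pair_self : ∀ x : L.grading 0, toTensorData.pair 0 0 x x = 0

/-- `(E, ι)` is the non-abelian exterior square `L ∧ L`. -/
def IsNAExtSq {L : LieSuperalgebra K} (a : LieSuperAction L L) (E : LieSuperalgebra K)
    (ι : ExtSqData a E) : Prop :=
  ∀ (Q : LieSuperalgebra K) (d : ExtSqData a Q),
    ∃! f : LieSuperHom E Q,
      ∀ (α β : ZMod 2) (x : L.grading α) (y : L.grading β),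
        f.toLinear (ι.pair α β x y) = d.pair α β x y

/-- Generating family for a free Lie superalgebra on a graded set. -/
structure FreeData (X : Type) (degX : X → ZMod 2) (F : LieSuperalgebra K) where
  gen : X → F.carrier
  gen_grading : ∀ x, gen x ∈ F.grading (degX x)

/-- `F` (with generators `i`) is the free Lie superalgebra on the graded set `(X, degX)`. -/
def IsFreeLieSuper {X : Type} (degX : X → ZMod 2) (F : LieSuperalgebra K)
    (i : FreeData X degX F) : Prop :=
  ∀ (M : LieSuperalgebra K) (j : FreeData X degX M),
    ∃! h : LieSuperHom F M, ∀ x, h.toLinear (i.gen x) = j.gen x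

/-- The submodule spanned by brackets `[S, T]`. -/
def bracketSpan (L : LieSuperalgebra K) (S T : Submodule K L.carrier) :
    Submodule K L.carrier :=
  Submodule.span K {z | ∃ x ∈ S, ∃ y ∈ T, z = L.bracket x y}

/-- Lower central series of a (sub-)Lie superalgebra `S ⊆ L`: `lcs 0 = S`,
`lcs (n+1) = [S, lcs n]`.  `S` is nilpotent of class `≤ c` iff `lcs c = ⊥`. -/
def lcs (L : LieSuperalgebra K) (S : Submodule K L.carrier) : ℕ → Submodule K L.carrier
  | 0 => S
  | n + 1 => bracketSpan L S (lcs L S n)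

/-- Derived series of `S ⊆ L`.  `S` is solvable of derived length `≤ c` iff `ds c = ⊥`. -/
def ds (L : LieSuperalgebra K) (S : Submodule K L.carrier) : ℕ → Submodule K L.carrier
  | 0 => S
  | n + 1 => bracketSpan L (ds L S n) (ds L S n)

/-- `S ⊆ L` is `n`-Engel: `ad(x)ⁿ = 0` on `S` for every `x ∈ S`. -/
def IsEngel (L : LieSuperalgebra K) (S : Submodule K L.carrier) (n : ℕ) : Prop :=
  ∀ x ∈ S, ∀ y ∈ S, ((L.bracket x) ^ n) y = 0

section Grading

variable {V W : Type} [AddCommGroup V] [Module K V] [AddCommGroup W] [Module K W]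

/-- The induced grading on a submodule. -/
def gradeSub (g : ZMod 2 → Submodule K V) (S : Submodule K V) : ZMod 2 → Submodule K S :=
  fun α => (g α).comap S.subtype

/-- The induced grading on a quotient module. -/
def gradeQuot (g : ZMod 2 → Submodule K V) (S : Submodule K V) : ZMod 2 → Submodule K (V ⧸ S) :=
  fun α => (g α).map S.mkQ

/-- The induced grading on a tensor product of supermodules. -/
def gradeTensor (gV : ZMod 2 → Submodule K V) (gW : ZMod 2 → Submodule K W) :
    ZMod 2 → Submodule K (V ⊗[K] W) :=
  fun γ => Submodule.span K {t | ∃ (α β : ZMod 2) (v : V) (w : W),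
    α + β = γ ∧ v ∈ gV α ∧ w ∈ gW β ∧ t = v ⊗ₜ[K] w}

/-- A linear equivalence is an isomorphism of supermodules for the given gradings. -/
def SuperEquiv (gV : ZMod 2 → Submodule K V) (gW : ZMod 2 → Submodule K W)
    (e : V ≃ₗ[K] W) : Prop :=
  ∀ α, (gV α).map e.toLinearMap = gW α

end Grading

/-- An associative (unital) superalgebra over `K`. -/
structure AssocSuperalgebra (K : Type) [CommRing K] : Type 1 where
  carrier : Type
  [isRing : Ring carrier]
  [isAlgebra : Algebra K carrier]
  grading : ZMod 2 → Submodule K carrier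
  isInternal : DirectSum.IsInternal grading
  grading_mul : ∀ (α β : ZMod 2) (x y : carrier),
    x ∈ grading α → y ∈ grading β → x * y ∈ grading (α + β)
  one_mem : (1 : carrier) ∈ grading 0

attribute [instance] AssocSuperalgebra.isRing AssocSuperalgebra.isAlgebra

/-- A (not necessarily unital) associative superalgebra over `K`. -/
structure NuAssocSuperalgebra (K : Type) [CommRing K] : Type 1 where
  carrier : Type
  [isRing : NonUnitalRing carrier]
  [isModule : Module K carrier]
  [isTower : IsScalarTower K carrier carrier]
  [isComm : SMulCommClass K carrier carrier]
  grading : ZMod 2 → Submodule K carrier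
  isInternal : DirectSum.IsInternal grading
  grading_mul : ∀ (α β : ZMod 2) (x y : carrier),
    x ∈ grading α → y ∈ grading β → x * y ∈ grading (α + β)

attribute [instance] NuAssocSuperalgebra.isRing NuAssocSuperalgebra.isModule
  NuAssocSuperalgebra.isTower NuAssocSuperalgebra.isComm

/-- The super-alternating relations inside `L ⊗ L`, whose quotient is `Λ²(L)`. -/
def altRel (L : LieSuperalgebra K) : Submodule K (L.carrier ⊗[K] L.carrier) :=
  Submodule.span K {t | ∃ (α β : ZMod 2) (x : L.grading α) (y : L.grading β),
    t = x.1 ⊗ₜ[K] y.1 + ssign α β • (y.1 ⊗ₜ[K] x.1)}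

/-- The super-alternating relations inside `L ⊗ (L ⊗ L)`, whose quotient is `Λ³(L)`. -/
def altRel3 (L : LieSuperalgebra K) :
    Submodule K (L.carrier ⊗[K] (L.carrier ⊗[K] L.carrier)) :=
  Submodule.span K
    ({t | ∃ (x : L.carrier) (r : L.carrier ⊗[K] L.carrier), r ∈ altRel L ∧ t = x ⊗ₜ[K] r} ∪
     {t | ∃ (α β : ZMod 2) (x : L.grading α) (y : L.grading β) (z : L.carrier),
        t = x.1 ⊗ₜ[K] (y.1 ⊗ₜ[K] z) + ssign α β • (y.1 ⊗ₜ[K] (x.1 ⊗ₜ[K] z))})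

theorem ssign_mul_ssign_mul_ssign (α β γ : ZMod 2) :
    ssign α β * (ssign β (α + γ) * ssign α γ) = ssign γ (α + β) := by
  revert α β γ
  decide

namespace LieSuperalgebra

/-- The projection of a Lie superalgebra onto one of its homogeneous components. -/
noncomputable def proj (L : LieSuperalgebra K) (α : ZMod 2) : L.carrier →ₗ[K] L.grading α :=
  DirectSum.component K (ZMod 2) (fun β => L.grading β) α ∘ₗ
    (LinearEquiv.ofBijective (DirectSum.coeLinearMap L.grading) L.isInternal).symm.toLinearMap

theorem proj_of_mem (L : LieSuperalgebra K) {α : ZMod 2} {x : L.carrier} (hx : x ∈ L.grading α) :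
    L.proj α x = ⟨x, hx⟩ := by
  have h : (LinearEquiv.ofBijective (DirectSum.coeLinearMap L.grading) L.isInternal).symm x
      = DirectSum.lof K (ZMod 2) (fun β => L.grading β) α ⟨x, hx⟩ := by
    rw [LinearEquiv.symm_apply_eq]
    exact (DirectSum.coeLinearMap_lof L.grading α ⟨x, hx⟩).symm
  simp only [proj, LinearMap.comp_apply, LinearEquiv.coe_coe, h, DirectSum.component.lof_self]

theorem proj_of_mem_ne (L : LieSuperalgebra K) {α β : ZMod 2} {x : L.carrier}
    (hx : x ∈ L.grading α) (hne : α ≠ β) : L.proj β x = 0 := by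
  have h : (LinearEquiv.ofBijective (DirectSum.coeLinearMap L.grading) L.isInternal).symm x
      = DirectSum.lof K (ZMod 2) (fun β => L.grading β) α ⟨x, hx⟩ := by
    rw [LinearEquiv.symm_apply_eq]
    exact (DirectSum.coeLinearMap_lof L.grading α ⟨x, hx⟩).symm
  simp only [proj, LinearMap.comp_apply, LinearEquiv.coe_coe, h, DirectSum.component.of,
    dif_neg hne]

theorem homogeneous_induction (L : LieSuperalgebra K) {p : L.carrier → Prop}
    (hom : ∀ α, ∀ x ∈ L.grading α, p x) (add : ∀ x y, p x → p y → p (x + y)) (x : L.carrier) :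
    p x := by
  have hx : x ∈ ⨆ α, L.grading α := by
    rw [L.isInternal.submodule_iSup_eq_top]
    trivial
  exact Submodule.iSup_induction _ (motive := p) hx hom (hom 0 0 (zero_mem _)) add

end LieSuperalgebra

/-- A pair of complementary submodules is an internal grading by `ℤ/2`. -/
theorem isInternal_zmod_two_iff_isCompl {V : Type} [AddCommGroup V] [Module K V]
    (g : ZMod 2 → Submodule K V) : DirectSum.IsInternal g ↔ IsCompl (g 0) (g 1) :=
  DirectSum.isInternal_submodule_iff_isCompl g (by decide)
    (Set.eq_univ_of_forall (by decide)).symm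

namespace LieSuperHom

/-- The identity homomorphism. -/
def id (L : LieSuperalgebra K) : LieSuperHom L L where
  toLinear := LinearMap.id
  map_grading _ _ hx := hx
  map_bracket _ _ := rfl

/-- The composition of homomorphisms. -/
def comp {L M N : LieSuperalgebra K} (g : LieSuperHom M N) (f : LieSuperHom L M) :
    LieSuperHom L N where
  toLinear := g.toLinear ∘ₗ f.toLinear
  map_grading α x hx := g.map_grading α _ (f.map_grading α x hx)
  map_bracket x y := by simp [f.map_bracket, g.map_bracket]

end LieSuperHom

namespace TensorData

variable {M N Q : LieSuperalgebra K} {aMN : LieSuperAction M N} {aNM : LieSuperAction N M}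

/-- The symbols `m ⊗ n`, as a bilinear map on homogeneous components. -/
def pairLinear (ι : TensorData aMN aNM Q) (α β : ZMod 2) :
    M.grading α →ₗ[K] N.grading β →ₗ[K] Q.carrier :=
  LinearMap.mk₂ K (ι.pair α β) (ι.pair_add_left α β) (ι.pair_smul_left α β)
    (ι.pair_add_right α β) (ι.pair_smul_right α β)

/-- The bilinear extension of the symbols `m ⊗ n` to all, not necessarily homogeneous,
elements. -/
noncomputable def bilin (ι : TensorData aMN aNM Q) : M.carrier →ₗ[K] N.carrier →ₗ[K] Q.carrier :=
  ∑ α, ∑ β, (ι.pairLinear α β).compl₁₂ (M.proj α) (N.proj β)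

theorem pair_eq_bilin (ι : TensorData aMN aNM Q) (α β : ZMod 2) (m : M.grading α)
    (n : N.grading β) : ι.pair α β m n = ι.bilin m.1 n.1 := by
  simp only [bilin, LinearMap.sum_apply, LinearMap.compl₁₂_apply]
  rw [Finset.sum_eq_single α, Finset.sum_eq_single β]
  · rw [M.proj_of_mem m.2, N.proj_of_mem n.2]
    rfl
  · intro b _ hb
    rw [N.proj_of_mem_ne n.2 hb.symm, map_zero]
  · simp
  · intro a _ ha
    simp [M.proj_of_mem_ne m.2 ha.symm]
  · simp

theorem bilin_mem_grading (ι : TensorData aMN aNM Q) {α β : ZMod 2} {m : M.carrier} {n : N.carrier}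
    (hm : m ∈ M.grading α) (hn : n ∈ N.grading β) : ι.bilin m n ∈ Q.grading (α + β) := by
  have h := ι.pair_grading α β ⟨m, hm⟩ ⟨n, hn⟩
  rwa [pair_eq_bilin] at h

/-- The span of the symbols `m ⊗ n`. -/
def span (ι : TensorData aMN aNM Q) : Submodule K Q.carrier :=
  Submodule.span K {t | ∃ α β m n, t = ι.pair α β m n}

theorem pair_mem_span (ι : TensorData aMN aNM Q) (α β : ZMod 2) (m : M.grading α)
    (n : N.grading β) : ι.pair α β m n ∈ ι.span :=
  Submodule.subset_span ⟨α, β, m, n, rfl⟩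

theorem bracket_mem_span (ι : TensorData aMN aNM Q) {s t : Q.carrier} (hs : s ∈ ι.span)
    (ht : t ∈ ι.span) : Q.bracket s t ∈ ι.span := by
  induction hs, ht using Submodule.span_induction₂ with
  | mem_mem x y hx hy =>
    obtain ⟨α, β, m, n, rfl⟩ := hx
    obtain ⟨α', β', m', n', rfl⟩ := hy
    rw [ι.pair_bracket_pair]
    exact neg_mem (zsmul_mem (ι.pair_mem_span _ _ _ _) _)
  | zero_left => simp
  | zero_right => simp
  | add_left x y z _ _ _ h₁ h₂ => simpa using add_mem h₁ h₂
  | add_right x y z _ _ _ h₁ h₂ => simpa using add_mem h₁ h₂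
  | smul_left r x y _ _ h => simpa using Submodule.smul_mem _ r h
  | smul_right r x y _ _ h => simpa using Submodule.smul_mem _ r h

theorem isInternal_gradeSub_span (ι : TensorData aMN aNM Q) :
    DirectSum.IsInternal (gradeSub Q.grading ι.span) := by
  have hQ := (isInternal_zmod_two_iff_isCompl _).1 Q.isInternal
  rw [isInternal_zmod_two_iff_isCompl]
  constructor
  · rw [Submodule.disjoint_def]
    intro x h₀ h₁
    exact Subtype.ext (Submodule.disjoint_def.1 hQ.disjoint x.1 h₀ h₁)
  · rw [codisjoint_iff, eq_top_iff]
    rintro ⟨x, hx⟩ -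
    induction hx using Submodule.span_induction with
    | mem x hx =>
      obtain ⟨α, β, m, n, rfl⟩ := hx
      have h := ι.pair_grading α β m n
      generalize α + β = γ at h
      fin_cases γ
      · exact Submodule.mem_sup_left h
      · exact Submodule.mem_sup_right h
    | zero => exact zero_mem _
    | add x y _ _ h₁ h₂ => exact add_mem h₁ h₂
    | smul r x _ h => exact Submodule.smul_mem _ r h

/-- The span of the symbols `m ⊗ n`, as a Lie superalgebra. -/
def spanSuperalgebra (ι : TensorData aMN aNM Q) : LieSuperalgebra K where
  carrier := ι.span
  grading := gradeSub Q.grading ι.span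
  isInternal := ι.isInternal_gradeSub_span
  bracket := LinearMap.mk₂ K (fun s t => ⟨Q.bracket s.1 t.1, ι.bracket_mem_span s.2 t.2⟩)
    (fun _ _ _ => Subtype.ext (by simp)) (fun _ _ _ => Subtype.ext (by simp))
    (fun _ _ _ => Subtype.ext (by simp)) (fun _ _ _ => Subtype.ext (by simp))
  bracket_grading α β x y hx hy := Q.bracket_grading α β x.1 y.1 hx hy
  super_skew α β x y hx hy := Subtype.ext (Q.super_skew α β x.1 y.1 hx hy)
  super_jacobi α β x y hx hy z := Subtype.ext (Q.super_jacobi α β x.1 y.1 hx hy z.1)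
  bracket_self_even x hx := Subtype.ext (Q.bracket_self_even x.1 hx)

/-- The inclusion of the span of the symbols `m ⊗ n`. -/
def spanInclusion (ι : TensorData aMN aNM Q) : LieSuperHom ι.spanSuperalgebra Q where
  toLinear := ι.span.subtype
  map_grading _ _ hx := hx
  map_bracket _ _ := rfl

/-- The symbols `m ⊗ n`, in their span. -/
def toSpan (ι : TensorData aMN aNM Q) : TensorData aMN aNM ι.spanSuperalgebra where
  pair α β m n := ⟨ι.pair α β m n, ι.pair_mem_span α β m n⟩
  pair_grading := ι.pair_grading
  pair_smul_left α β c m n := Subtype.ext (ι.pair_smul_left α β c m n)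
  pair_smul_right α β c m n := Subtype.ext (ι.pair_smul_right α β c m n)
  pair_add_left α β m m' n := Subtype.ext (ι.pair_add_left α β m m' n)
  pair_add_right α β m n n' := Subtype.ext (ι.pair_add_right α β m n n')
  pair_bracket_left α α' β m m' n := Subtype.ext (ι.pair_bracket_left α α' β m m' n)
  pair_bracket_right α β β' m n n' := Subtype.ext (ι.pair_bracket_right α β β' m n n')
  pair_bracket_pair α β α' β' m n m' n' :=
    Subtype.ext (ι.pair_bracket_pair α β α' β' m n m' n')

end TensorData

namespace ExtSqData

variable {L : LieSuperalgebra K} {a : LieSuperAction L L} {Q : LieSuperalgebra K}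

/-- The symbols `x ∧ y`, in their span. -/
def toSpan (ι : ExtSqData a Q) : ExtSqData a ι.spanSuperalgebra where
  toTensorData := ι.toTensorData.toSpan
  pair_alt α β x y := Subtype.ext (ι.pair_alt α β x y)
  pair_self x := Subtype.ext (ι.pair_self x)

theorem bilin_alt (ι : ExtSqData a Q) {α β : ZMod 2} {x y : L.carrier}
    (hx : x ∈ L.grading α) (hy : y ∈ L.grading β) :
    ι.bilin x y = -(ssign α β • ι.bilin y x) := by
  have h := ι.pair_alt α β ⟨x, hx⟩ ⟨y, hy⟩
  simp only [TensorData.pair_eq_bilin] at h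
  exact eq_neg_of_add_eq_zero_left h

theorem bilin_self (ι : ExtSqData a Q) {x : L.carrier} (hx : x ∈ L.grading 0) :
    ι.bilin x x = 0 := by
  have h := ι.pair_self ⟨x, hx⟩
  rwa [TensorData.pair_eq_bilin] at h

theorem bilin_jacobi (ι : ExtSqData a Q) (ha : ∀ x y, a.act x y = L.bracket x y) {α β : ZMod 2}
    {x y : L.carrier} (hx : x ∈ L.grading α) (hy : y ∈ L.grading β) (z : L.carrier) :
    ι.bilin x (L.bracket y z)
      = ι.bilin (L.bracket x y) z + ssign α β • ι.bilin y (L.bracket x z) := by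
  induction z using L.homogeneous_induction with
  | hom γ z hz =>
    have h := ι.pair_bracket_left α β γ ⟨x, hx⟩ ⟨y, hy⟩ ⟨z, hz⟩
    simp only [TensorData.pair_eq_bilin, ha] at h
    rw [h, sub_add_cancel]
  | add z z' h h' =>
    simp only [map_add, h, h', smul_add]
    abel

theorem span_eq_top {ι : ExtSqData a Q} (hι : IsNAExtSq a Q ι) : ι.span = ⊤ := by
  obtain ⟨f, hf, -⟩ := hι _ ι.toSpan
  have h : ι.spanInclusion.comp f = LieSuperHom.id Q :=
    (hι Q ι).unique (fun α β x y => congrArg Subtype.val (hf α β x y)) fun _ _ _ _ => rfl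
  rw [eq_top_iff]
  intro e _
  have he : (f.toLinear e).1 = e := LinearMap.congr_fun (congrArg LieSuperHom.toLinear h) e
  exact he ▸ (f.toLinear e).2

/-- The bracket of `L`, regarded as a family of symbols `x ∧ y` in `L`. -/
def ofBracket (ha : ∀ x y, a.act x y = L.bracket x y) : ExtSqData a L where
  pair _ _ x y := L.bracket x.1 y.1
  pair_grading α β x y := L.bracket_grading α β _ _ x.2 y.2
  pair_smul_left _ _ c x y := by simp
  pair_smul_right _ _ c x y := by simp
  pair_add_left _ _ x x' y := by simp
  pair_add_right _ _ x y y' := by simp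
  pair_bracket_left α β γ x y z := by
    simp only [ha]
    rw [L.super_jacobi α β _ _ x.2 y.2, add_sub_cancel_right]
  pair_bracket_right α β γ x y z := by
    simp only [ha]
    rw [L.super_jacobi α β _ _ x.2 y.2, L.super_skew _ _ _ _ x.2 y.2,
      L.super_skew _ _ _ _ y.2 (L.bracket_grading _ _ _ _ x.2 z.2),
      L.super_skew _ _ _ _ x.2 z.2]
    simp only [map_neg, map_zsmul, LinearMap.neg_apply, LinearMap.smul_apply, smul_neg, neg_neg,
      smul_smul]
    rw [add_comm, sub_eq_add_neg]
    congr 2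
    exact ssign_mul_ssign_mul_ssign α β γ
  pair_bracket_pair α β α' β' x y x' y' := by
    simp only [ha]
    rw [L.super_skew _ _ _ _ x.2 y.2]
    simp
  pair_alt α β x y := by
    rw [L.super_skew _ _ _ _ x.2 y.2]
    simp
  pair_self x := L.bracket_self_even _ x.2

end ExtSqData

section FreeExtension

variable {X : Type} {degX : X → ZMod 2} {F E : LieSuperalgebra K} (i : FreeData X degX F)
  (f : LieSuperHom E F)

/-- The linear map `E ⊕ K⟨X⟩ → F` given by `f` on `E` and by the generators on `X`. -/
noncomputable def freeExtensionProj : E.carrier × (X →₀ K) →ₗ[K] F.carrier :=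
  f.toLinear.coprod (Finsupp.linearCombination K i.gen)

theorem freeExtensionProj_inl (e : E.carrier) :
    freeExtensionProj i f (LinearMap.inl K E.carrier (X →₀ K) e) = f.toLinear e := by
  simp [freeExtensionProj]

/-- The grading on `E ⊕ K⟨X⟩`. -/
noncomputable def freeExtensionGrading (degX : X → ZMod 2) (E : LieSuperalgebra K) (α : ZMod 2) :
    Submodule K (E.carrier × (X →₀ K)) :=
  (E.grading α).prod (Finsupp.supported K K {x | degX x = α})

theorem isInternal_freeExtensionGrading :
    DirectSum.IsInternal (freeExtensionGrading degX E) := by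
  have hE := (isInternal_zmod_two_iff_isCompl _).1 E.isInternal
  have hc : IsCompl {x | degX x = 0} {x | degX x = 1} := by
    rw [isCompl_iff, Set.disjoint_iff, codisjoint_iff]
    constructor
    · rintro x ⟨h₀, h₁⟩
      exact absurd (h₀.symm.trans h₁) (by decide)
    · ext x
      have : ∀ a : ZMod 2, a = 0 ∨ a = 1 := by decide
      simpa using this (degX x)
  rw [isInternal_zmod_two_iff_isCompl]
  constructor
  · rw [disjoint_iff, freeExtensionGrading, freeExtensionGrading, Submodule.prod_inf_prod,
      hE.inf_eq_bot, (Finsupp.disjoint_supported_supported hc.disjoint).eq_bot,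
      Submodule.prod_bot]
  · rw [codisjoint_iff, freeExtensionGrading, freeExtensionGrading, Submodule.prod_sup_prod,
      hE.sup_eq_top, (Finsupp.codisjoint_supported_supported hc.codisjoint).eq_top,
      Submodule.prod_top]

theorem freeExtensionProj_mem_grading {α : ZMod 2} {g : E.carrier × (X →₀ K)}
    (hg : g ∈ freeExtensionGrading degX E α) : freeExtensionProj i f g ∈ F.grading α := by
  rw [freeExtensionProj, LinearMap.coprod_apply]
  refine add_mem (f.map_grading _ _ hg.1) ?_
  rw [Finsupp.linearCombination_apply]
  refine Submodule.sum_mem _ fun x hx => Submodule.smul_mem _ _ ?_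
  have hxα : degX x = α := hg.2 hx
  exact hxα ▸ i.gen_grading x

variable {a : LieSuperAction F F} (ι : ExtSqData a E)

theorem toLinear_bilin (hf : ∀ (α β : ZMod 2) (x : F.grading α) (y : F.grading β),
      f.toLinear (ι.pair α β x y) = F.bracket x.1 y.1) (x y : F.carrier) :
    f.toLinear (ι.bilin x y) = F.bracket x y := by
  induction x using F.homogeneous_induction with
  | hom α x hx =>
    induction y using F.homogeneous_induction with
    | hom β y hy => rw [← hf α β ⟨x, hx⟩ ⟨y, hy⟩, TensorData.pair_eq_bilin]
    | add y y' h h' => simp only [map_add, h, h']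
  | add x x' h h' => simp only [map_add, LinearMap.add_apply, h, h']

/-- The Lie superalgebra `E ⊕ K⟨X⟩`, with bracket `[g, h] = π g ∧ π h` for the projection
`π = freeExtensionProj i f`. -/
noncomputable def freeExtension (ha : ∀ x y, a.act x y = F.bracket x y)
    (hf : ∀ (α β : ZMod 2) (x : F.grading α) (y : F.grading β),
      f.toLinear (ι.pair α β x y) = F.bracket x.1 y.1) : LieSuperalgebra K where
  carrier := E.carrier × (X →₀ K)
  grading := freeExtensionGrading degX E
  isInternal := isInternal_freeExtensionGrading
  bracket := (ι.bilin.compl₁₂ (freeExtensionProj i f) (freeExtensionProj i f)).compr₂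
    (LinearMap.inl K _ _)
  bracket_grading α β x y hx hy :=
    ⟨ι.bilin_mem_grading (freeExtensionProj_mem_grading i f hx)
      (freeExtensionProj_mem_grading i f hy), zero_mem _⟩
  super_skew α β x y hx hy := by
    simp only [LinearMap.compr₂_apply, LinearMap.compl₁₂_apply]
    rw [ι.bilin_alt (freeExtensionProj_mem_grading i f hx)
      (freeExtensionProj_mem_grading i f hy), map_neg, map_zsmul]
  super_jacobi α β x y hx hy z := by
    simp only [LinearMap.compr₂_apply, LinearMap.compl₁₂_apply, freeExtensionProj_inl,
      toLinear_bilin f ι hf]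
    rw [ι.bilin_jacobi ha (freeExtensionProj_mem_grading i f hx)
      (freeExtensionProj_mem_grading i f hy), map_add, map_zsmul]
  bracket_self_even x hx := by
    simp only [LinearMap.compr₂_apply, LinearMap.compl₁₂_apply]
    rw [ι.bilin_self (freeExtensionProj_mem_grading i f hx), map_zero]

theorem injective_of_isFreeLieSuper (hF : IsFreeLieSuper degX F i)
    (ha : ∀ x y, a.act x y = F.bracket x y) (hι : IsNAExtSq a E ι)
    (hf : ∀ (α β : ZMod 2) (x : F.grading α) (y : F.grading β),
      f.toLinear (ι.pair α β x y) = F.bracket x.1 y.1) :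
    Function.Injective f.toLinear := by
  let G := freeExtension i f ι ha hf
  let π : LieSuperHom G F :=
    { toLinear := freeExtensionProj i f
      map_grading := fun α x hx => freeExtensionProj_mem_grading i f hx
      map_bracket := fun x y => by
        change freeExtensionProj i f (LinearMap.inl K _ _ (ι.bilin (freeExtensionProj i f x)
          (freeExtensionProj i f y))) = _
        rw [freeExtensionProj_inl]
        exact toLinear_bilin f ι hf _ _ }
  let j : FreeData X degX G :=
    { gen := fun x => ((0 : E.carrier), Finsupp.single x (1 : K))
      gen_grading := fun x => ⟨zero_mem _, Finsupp.single_mem_supported K _ rfl⟩ }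
  obtain ⟨σ, hσ, -⟩ := hF G j
  have hπσ : π.comp σ = LieSuperHom.id F := by
    refine (hF F i).unique (fun x => ?_) fun _ => rfl
    change freeExtensionProj i f (σ.toLinear (i.gen x)) = i.gen x
    rw [hσ]
    simp [j, freeExtensionProj]
  have hπσ' (x : F.carrier) : freeExtensionProj i f (σ.toLinear x) = x :=
    LinearMap.congr_fun (congrArg LieSuperHom.toLinear hπσ) x
  have hσf : σ.toLinear ∘ₗ f.toLinear = LinearMap.inl K E.carrier (X →₀ K) := by
    refine LinearMap.ext_on (ExtSqData.span_eq_top hι) ?_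
    rintro _ ⟨α, β, x, y, rfl⟩
    rw [LinearMap.comp_apply, hf, σ.map_bracket, TensorData.pair_eq_bilin]
    change LinearMap.inl K _ _ (ι.bilin (freeExtensionProj i f (σ.toLinear x.1))
      (freeExtensionProj i f (σ.toLinear y.1))) = _
    rw [hπσ', hπσ']
    rfl
  refine Function.Injective.of_comp (f := σ.toLinear) ?_
  rw [← LinearMap.coe_comp, hσf]
  exact LinearMap.inl_injective

theorem range_eq_bracketSpan (hι : IsNAExtSq a E ι)
    (hf : ∀ (α β : ZMod 2) (x : F.grading α) (y : F.grading β),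
      f.toLinear (ι.pair α β x y) = F.bracket x.1 y.1) :
    LinearMap.range f.toLinear = bracketSpan F ⊤ ⊤ := by
  apply le_antisymm
  · rw [LinearMap.range_eq_map, ← ExtSqData.span_eq_top hι, TensorData.span, Submodule.map_span,
      Submodule.span_le]
    rintro _ ⟨_, ⟨α, β, x, y, rfl⟩, rfl⟩
    exact Submodule.subset_span ⟨x.1, trivial, y.1, trivial, hf α β x y⟩
  · rw [bracketSpan, Submodule.span_le]
    rintro _ ⟨x, -, y, -, rfl⟩
    exact ⟨ι.bilin x y, toLinear_bilin f ι hf x y⟩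

end FreeExtension

/-- For a free Lie superalgebra `F` on a graded set `X`, the Lie
superalgebra homomorphism `F ∧ F → F`, `x ∧ y ↦ [x,y]`, is injective; hence
`F ∧ F ≅ [F,F]`. -/
theorem statement17 {K : Type} [CommRing K] (X : Type) (degX : X → ZMod 2)
    (F : LieSuperalgebra K) (i : FreeData X degX F) (hF : IsFreeLieSuper degX F i)
    -- `F` acts on itself by the adjoint action
    (ad : LieSuperAction F F) (had : ∀ x y : F.carrier, ad.act x y = F.bracket x y)
    -- `(E, ι)` is the non-abelian exterior square `F ∧ F`
    (E : LieSuperalgebra K) (ι : ExtSqData ad E) (hE : IsNAExtSq ad E ι) :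
    -- the homomorphism `F ∧ F → F`, `x ∧ y ↦ [x,y]`, exists ...
    (∃ f : LieSuperHom E F,
      ∀ (α β : ZMod 2) (x : F.grading α) (y : F.grading β),
        f.toLinear (ι.pair α β x y) = F.bracket x.1 y.1) ∧
    -- ... and any such homomorphism is injective, with image `[F, F]`
    (∀ f : LieSuperHom E F,
      (∀ (α β : ZMod 2) (x : F.grading α) (y : F.grading β),
        f.toLinear (ι.pair α β x y) = F.bracket x.1 y.1) →
      Function.Injective f.toLinear ∧
      LinearMap.range f.toLinear = bracketSpan F ⊤ ⊤) := by
  refine ⟨(hE F (ExtSqData.ofBracket had)).exists, fun f hf => ⟨?_, ?_⟩⟩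
  · exact injective_of_isFreeLieSuper i f ι hF had hE hf
  · exact range_eq_bracketSpan f ι hE hf

end SuperNA
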